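/- Let p', q', r' be words over {0,1} and let a, b ∈ {0,1}. Set p = h(p')·0, q = a·1·h(q')·0·b, and r = 1·h(r'). Then it is not the case that both p ~_2 q and p ~_2 r. -/

import Mathlib

/-- Number of occurrences of `v` as a scattered subword (subsequence) of `u`. -/
def binomC {α : Type*} [DecidableEq α] (u v : List α) : ℕ := u.sublists.count v

/-- Two words are 2-binomially equivalent. -/
def binEq2 {α : Type*} [DecidableEq α] (u v : List α) : Prop :=
  ∀ x : List α, x.length ≤ 2 → binomC u x = binomC v x

/-- The morphism h : 0 ↦ 001, 1 ↦ 011. -/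
def h : Fin 2 → List (Fin 2) := ![[0,0,1],[0,1,1]]

/-- Apply the morphism h to a word. -/
def hWord (w : List (Fin 2)) : List (Fin 2) := w.flatMap h

theorem binomC_nil_right {α : Type*} [DecidableEq α] (u : List α) : binomC u [] = 1 := by
  induction u with
  | nil => simp [binomC]
  | cons x u ih =>
    unfold binomC at *
    rw [(List.sublists_perm_sublists' _).count_eq] at *
    rw [List.sublists'_cons, List.count_append, ih]
    simp [List.count_eq_zero]

theorem binomC_nil_cons {α : Type*} [DecidableEq α] (y : α) (v : List α) :
    binomC [] (y :: v) = 0 := by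
  simp [binomC]

theorem binomC_cons_cons {α : Type*} [DecidableEq α] (x y : α) (u v : List α) :
    binomC (x :: u) (y :: v) = binomC u (y :: v) + if x = y then binomC u v else 0 := by
  unfold binomC
  simp only [(List.sublists_perm_sublists' _).count_eq]
  rw [List.sublists'_cons, List.count_append]
  congr 1
  split_ifs with hxy
  · subst hxy
    exact List.count_map_of_injective _ _ (List.cons_injective) _
  · rw [List.count_eq_zero]
    simp [hxy]

theorem hWord_zero_cons (w : List (Fin 2)) : hWord (0 :: w) = 0 :: 0 :: 1 :: hWord w := by
  simp [hWord, h]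

theorem hWord_one_cons (w : List (Fin 2)) : hWord (1 :: w) = 0 :: 1 :: 1 :: hWord w := by
  simp [hWord, h]

theorem binomC_hWord_append_one (w t : List (Fin 2)) :
    binomC (hWord w ++ t) [1] = w.length + w.count 1 + binomC t [1] := by
  induction w with
  | nil => simp [hWord]
  | cons c w ih =>
    fin_cases c <;>
      simp [hWord_zero_cons, hWord_one_cons, binomC_cons_cons, binomC_nil_right, ih] <;> omega

theorem binomC_hWord_append_zero (w t : List (Fin 2)) :
    binomC (hWord w ++ t) [0] + w.count 1 = 2 * w.length + binomC t [0] := by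
  induction w with
  | nil => simp [hWord]
  | cons c w ih =>
    fin_cases c <;>
      simp [hWord_zero_cons, hWord_one_cons, binomC_cons_cons, binomC_nil_right] <;> omega

/-- Modulo 3, the number of occurrences of `01` in `h(w)t` depends on `w` only through its
length and its number of ones. -/
theorem binomC_hWord_append_zero_one (w t : List (Fin 2)) :
    (binomC (hWord w ++ t) [0, 1] : ZMod 3) =
      (w.length ^ 2 + w.length + w.count 1 ^ 2 - w.length * w.count 1) +
        (2 * w.length - w.count 1) * binomC t [1] + binomC t [0, 1] := by
  induction w with
  | nil => simp [hWord]
  | cons c w ih =>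
    fin_cases c <;>
      simp [hWord_zero_cons, hWord_one_cons, binomC_cons_cons, binomC_nil_right, ih,
        binomC_hWord_append_one]
    · have three : (3 : ZMod 3) = 0 := rfl
      linear_combination (w.count 1 : ZMod 3) * three
    · ring

/-- Words of the form h(p')0, a1h(q')0b, 1h(r') cannot be pairwise 2-binomially equivalent. -/
theorem cube_desubstitution_case_one
    (p' q' r' : List (Fin 2)) (a b : Fin 2) :
    ¬ (binEq2 (hWord p' ++ [0]) (a :: 1 :: (hWord q' ++ [0, b])) ∧
       binEq2 (hWord p' ++ [0]) ((1 : Fin 2) :: hWord r')) := by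
  rintro ⟨hq, hr⟩
  have q0 := hq [0] (by simp)
  have q1 := hq [1] (by simp)
  have q01 := congrArg (Nat.cast : ℕ → ZMod 3) (hq [0, 1] (by simp))
  have r0 := hr [0] (by simp)
  have r1 := hr [1] (by simp)
  have r01 := congrArg (Nat.cast : ℕ → ZMod 3) (hr [0, 1] (by simp))
  have p0 := binomC_hWord_append_zero p' [0]
  have p1 := binomC_hWord_append_one p' [0]
  have s0 := binomC_hWord_append_zero q' [0, b]
  have s1 := binomC_hWord_append_one q' [0, b]
  have t0 := binomC_hWord_append_zero r' []
  have t1 := binomC_hWord_append_one r' []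
  have p01 := binomC_hWord_append_zero_one p' [0]
  have s01 := binomC_hWord_append_zero_one q' [0, b]
  have t01 := binomC_hWord_append_zero_one r' []
  rw [List.append_nil] at t0 t1 t01
  have hn : p'.length = q'.length + 1 := by
    fin_cases a <;> fin_cases b <;>
      simp [binomC_cons_cons, binomC_nil_right, binomC_nil_cons] at * <;> omega
  have hm : r'.length = q'.length + 1 := by
    simp [binomC_cons_cons, binomC_nil_right, binomC_nil_cons] at *
    omega
  have hx : p'.count 1 = r'.count 1 + 1 := by
    simp [binomC_cons_cons, binomC_nil_right, binomC_nil_cons] at *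
    omega
  have hz : q'.count 1 + a.val + b.val = r'.count 1 + 1 := by
    fin_cases a <;> fin_cases b <;>
      simp [binomC_cons_cons, binomC_nil_right, binomC_nil_cons] at * <;> omega
  replace hz := congrArg (Nat.cast : ℕ → ZMod 3) hz
  rw [p01] at q01 r01
  rw [hn, hx] at q01 r01
  rw [hm] at t01
  clear hq hr q0 q1 r0 r1 p0 p1 s0 t0 t1 p01 hn hm hx
  fin_cases a <;> fin_cases b <;>
    simp [binomC_cons_cons, binomC_nil_right, binomC_nil_cons] at * <;>
    simp only [s01, t01, s1] at q01 r01 <;> push_cast at q01 r01 <;>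
    clear s01 t01 s1 <;>
    generalize (q'.length : ZMod 3) = m, (q'.count 1 : ZMod 3) = z,
      (r'.count 1 : ZMod 3) = y at * <;>
    revert m z y <;> decide
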